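/- arXiv:1910.00999 — 6 statements merged into one kernel-verified Lean document; each statement's English description precedes it below -/
import Mathlib

section
/- Let H and G be finite groups and let F: Set_H → Set_G be a functor which preserves all small limits and all filtered colimits. Then F is naturally isomorphic to the functor Hom_H(T, −) for some finite (H,G)-biset T. -/
open CategoryTheory MulOpposite

universe u

/-- The category of left `M`-sets, for a monoid `M`: objects are types equipped with a
left `M`-action. -/
structure MSet (M : Type u) [Monoid M] : Type (u + 1) where
  carrier : Type u
  [mulAction : MulAction M carrier]

attribute [instance] MSet.mulAction

/-- Morphisms of `M`-sets: `M`-equivariant maps. -/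
@[ext]
structure MSetHom {M : Type u} [Monoid M] (X Y : MSet M) : Type u where
  toFun : X.carrier → Y.carrier
  equivariant : ∀ (m : M) (x : X.carrier), toFun (m • x) = m • toFun x

instance (M : Type u) [Monoid M] : Category (MSet M) where
  Hom X Y := MSetHom X Y
  id X := ⟨id, fun _ _ => rfl⟩
  comp f g := ⟨g.toFun ∘ f.toFun, fun m x => by
    simp only [Function.comp_apply, f.equivariant, g.equivariant]⟩
  id_comp f := by apply MSetHom.ext; rfl
  comp_id f := by apply MSetHom.ext; rfl
  assoc f g h := by apply MSetHom.ext; rfl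

variable (H G : Type u) [Group H] [Group G]

/-- An `(H,G)`-biset -- a set with commuting left `H`-action and right `G`-action -- is
modelled as a left `(H × Gᵐᵒᵖ)`-set: the left action of `h` is `(h, 1) • _` and the right
action of `g` is `(1, op g) • _`. -/
abbrev Biset : Type (u + 1) := MSet (H × Gᵐᵒᵖ)

variable {H G}

/-- `Hom_H(T, X)`: the left `H`-equivariant maps from the biset `T` to the `H`-set `X`. -/
abbrev BisetHom (T : Biset H G) (X : MSet H) : Type u :=
  { f : T.carrier → X.carrier //
    ∀ (h : H) (t : T.carrier), f ((h, (1 : Gᵐᵒᵖ)) • t) = h • f t }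

/-- `Hom_H(T, X)` is a left `G`-set via `(g • f) t = f (t • g)`. -/
instance (T : Biset H G) (X : MSet H) : MulAction G (BisetHom T X) where
  smul g f := ⟨fun t => f.1 (((1 : H), op g) • t), fun h t => by
    have key : ((1 : H), op g) * (h, (1 : Gᵐᵒᵖ)) = (h, (1 : Gᵐᵒᵖ)) * ((1 : H), op g) := by
      simp [Prod.mk_mul_mk]
    dsimp only
    rw [smul_smul, key, ← smul_smul]
    exact f.2 h _⟩
  one_smul f := Subtype.ext <| funext fun t => by
    show f.1 (((1 : H), op (1 : G)) • t) = f.1 t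
    have : ((1 : H), op (1 : G)) = (1 : H × Gᵐᵒᵖ) := by simp
    rw [this, one_smul]
  mul_smul g g' f := Subtype.ext <| funext fun t => by
    show f.1 (((1 : H), op (g * g')) • t) = f.1 (((1 : H), op g') • ((1 : H), op g) • t)
    rw [smul_smul]
    simp [Prod.mk_mul_mk]

variable (H G)

/-- The functor `Hom_H(T, −) : Set_H ⥤ Set_G` associated to an `(H,G)`-biset `T`,
sending `X` to the `G`-set of left `H`-equivariant maps `T → X`. -/
def bisetHomFunctor (T : Biset H G) : MSet H ⥤ MSet G where
  obj X := ⟨BisetHom T X⟩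
  map {X Y} φ :=
    { toFun := fun f => ⟨φ.toFun ∘ f.1, fun h t => by
        simp only [Function.comp_apply, f.2, φ.equivariant]⟩
      equivariant := fun g f => Subtype.ext rfl }
  map_id X := by
    apply MSetHom.ext; funext f; exact Subtype.ext rfl
  map_comp f g := by
    apply MSetHom.ext; funext f; exact Subtype.ext rfl

namespace MSet

variable {M : Type u} [Monoid M]

@[simp]
lemma id_toFun (X : MSet M) (x : X.carrier) : MSetHom.toFun (𝟙 X) x = x := rfl

@[simp]
lemma comp_toFun {X Y Z : MSet M} (f : X ⟶ Y) (g : Y ⟶ Z) (x : X.carrier) :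
    MSetHom.toFun (f ≫ g) x = MSetHom.toFun g (MSetHom.toFun f x) := rfl

lemma hom_ext {X Y : MSet M} {f g : X ⟶ Y}
    (h : ∀ x, MSetHom.toFun f x = MSetHom.toFun g x) : f = g :=
  MSetHom.ext (funext h)

lemma congr_toFun {X Y : MSet M} {f g : X ⟶ Y} (h : f = g) (x : X.carrier) :
    MSetHom.toFun f x = MSetHom.toFun g x := by rw [h]

/-- A bijective equivariant map is an isomorphism of `M`-sets. -/
noncomputable def isoOfBijective {X Y : MSet M} (f : X ⟶ Y)
    (hf : Function.Bijective (MSetHom.toFun f)) : X ≅ Y where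
  hom := f
  inv :=
    { toFun := (Equiv.ofBijective _ hf).symm
      equivariant := fun m y => by
        apply hf.injective
        rw [f.equivariant, Equiv.ofBijective_apply_symm_apply _ hf,
          Equiv.ofBijective_apply_symm_apply _ hf] }
  hom_inv_id := hom_ext fun x => Equiv.ofBijective_symm_apply_apply _ hf x
  inv_hom_id := hom_ext fun y => Equiv.ofBijective_apply_symm_apply _ hf y

section Limits

variable {J : Type u} [SmallCategory J] (K : J ⥤ MSet M)

/-- The compatible families of elements of a diagram of `M`-sets. -/
def sections : MSet M where
  carrier := { s : ∀ j, (K.obj j).carrier // ∀ {i j} (f : i ⟶ j), (K.map f).toFun (s i) = s j }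
  mulAction :=
    { smul := fun m s => ⟨fun j => m • s.1 j, fun f => by rw [(K.map f).equivariant, s.2]⟩
      one_smul := fun s => Subtype.ext (funext fun j => one_smul M (s.1 j))
      mul_smul := fun m n s => Subtype.ext (funext fun j => mul_smul m n (s.1 j)) }

/-- The cone of projections from the compatible families. -/
def sectionsCone : Limits.Cone K where
  pt := sections K
  π :=
    { app := fun j => ⟨fun s => s.1 j, fun _ _ => rfl⟩
      naturality := fun _ _ f => hom_ext fun s => (s.2 f).symm }

/-- The compatible families form a limit of the diagram. -/
def sectionsConeIsLimit : Limits.IsLimit (sectionsCone K) where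
  lift c :=
    { toFun := fun x => ⟨fun j => (c.π.app j).toFun x, fun f => congr_toFun (c.w f) x⟩
      equivariant := fun m x => Subtype.ext (funext fun j => (c.π.app j).equivariant m x) }
  fac _ _ := rfl
  uniq _ _ hf := hom_ext fun x => Subtype.ext (funext fun j => congr_toFun (hf j) x)

instance : Limits.HasLimitsOfSize.{u, u} (MSet M) :=
  ⟨fun _ _ => ⟨fun K => ⟨⟨sectionsCone K, sectionsConeIsLimit K⟩⟩⟩⟩

end Limits

/-- A subset of an `M`-set closed under the action, as an `M`-set. -/
def ofSub {X : MSet M} (S : SubMulAction M X.carrier) : MSet M := ⟨S⟩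

/-- The inclusion of a subset closed under the action. -/
def incl {X : MSet M} (S : SubMulAction M X.carrier) : ofSub S ⟶ X :=
  ⟨Subtype.val, fun _ _ => rfl⟩

/-- The inclusion between nested subsets closed under the action. -/
def inclusion {X : MSet M} {S T : SubMulAction M X.carrier} (h : S ≤ T) : ofSub S ⟶ ofSub T :=
  ⟨fun x => ⟨x.1, h x.2⟩, fun _ _ => rfl⟩

/-- The legs of a colimit cocone of `M`-sets are jointly surjective. -/
lemma jointly_surjective {J : Type*} [Category* J] {K : J ⥤ MSet M} {c : Limits.Cocone K}
    (hc : Limits.IsColimit c) (x : c.pt.carrier) :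
    ∃ j y, (c.ι.app j).toFun y = x := by
  let I : SubMulAction M c.pt.carrier :=
    { carrier := { x | ∃ j y, (c.ι.app j).toFun y = x }
      smul_mem' := by
        rintro m _ ⟨j, y, rfl⟩
        exact ⟨j, m • y, (c.ι.app j).equivariant m y⟩ }
  let d : Limits.Cocone K :=
    { pt := ofSub I
      ι :=
        { app := fun j => ⟨fun y => ⟨(c.ι.app j).toFun y, j, y, rfl⟩,
            fun m y => Subtype.ext ((c.ι.app j).equivariant m y)⟩
          naturality := fun i j f => hom_ext fun y => Subtype.ext (congr_toFun (c.w f) y) } }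
  have h : hc.desc d ≫ incl I = 𝟙 c.pt := hc.hom_ext fun j => by
    rw [hc.fac_assoc, Category.comp_id]
    rfl
  obtain ⟨j, y, hy⟩ := (MSetHom.toFun (hc.desc d) x).2
  exact ⟨j, y, hy.trans (congr_toFun h x)⟩

variable (M) in
/-- The monoid acting on itself by left multiplication. -/
def regular : MSet M := ⟨M⟩

/-- The equivariant map from the regular `M`-set that picks out an element. -/
def pick {X : MSet M} (x : X.carrier) : regular M ⟶ X :=
  ⟨fun m : M => m • x, fun m n => mul_smul (α := M) m n x⟩

lemma pick_one {X : MSet M} (x : X.carrier) : MSetHom.toFun (pick x) (1 : M) = x :=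
  one_smul M x

lemma regular_hom_ext {X : MSet M} {f g : regular M ⟶ X}
    (h : MSetHom.toFun f (1 : M) = MSetHom.toFun g (1 : M)) : f = g :=
  hom_ext fun m => by
    have hm : m = (show M from m) • (show (regular M).carrier from (1 : M)) :=
      (mul_one (M := M) m).symm
    rw [hm, f.equivariant, g.equivariant]
    exact congrArg _ h

section FiniteSubsets

variable (X : MSet M)

/-- The finite subsets of an `M`-set closed under the action. -/
abbrev FiniteSub : Type u := { S : SubMulAction M X.carrier // Finite S }

instance : Nonempty (FiniteSub X) :=
  ⟨⊥, Set.finite_empty.to_subtype⟩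

instance : IsDirectedOrder (FiniteSub X) where
  directed S T := by
    have := S.2
    have := T.2
    refine ⟨⟨S.1 ⊔ T.1, ?_⟩, show S.1 ≤ _ from le_sup_left, show T.1 ≤ _ from le_sup_right⟩
    exact ((Set.toFinite (S.1 : Set X.carrier)).union
      (Set.toFinite (T.1 : Set X.carrier))).to_subtype

/-- The diagram of finite subsets of an `M`-set closed under the action. -/
def finiteSubDiagram : FiniteSub X ⥤ MSet M where
  obj S := ofSub S.1
  map f := inclusion (leOfHom f)

/-- An `M`-set as a cocone under its finite subsets closed under the action. -/
def finiteSubCocone : Limits.Cocone (finiteSubDiagram X) where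
  pt := X
  ι := { app := fun S => incl S.1 }

/-- The subset of an `M`-set generated by one element. -/
def cyclic {X : MSet M} (x : X.carrier) : SubMulAction M X.carrier where
  carrier := MulAction.orbit M x
  smul_mem' m _ h := MulAction.mem_orbit_of_mem_orbit m h

lemma mem_cyclic {X : MSet M} (x : X.carrier) : x ∈ cyclic x := MulAction.mem_orbit_self x

lemma cyclic_le {X : MSet M} {x : X.carrier} {S : SubMulAction M X.carrier} (hx : x ∈ S) :
    cyclic x ≤ S := by
  rintro _ ⟨m, rfl⟩
  exact S.smul_mem m hx

variable [Finite M]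

/-- The finite subset generated by one element, for a finite monoid. -/
def finiteCyclic {X : MSet M} (x : X.carrier) : FiniteSub X :=
  ⟨cyclic x, (Set.finite_range fun m : M => m • x).to_subtype⟩

/-- For a finite monoid `M`, an `M`-set is the colimit of its finite subsets closed under the
action. -/
def finiteSubCoconeIsColimit : Limits.IsColimit (finiteSubCocone X) where
  desc s :=
    { toFun := fun x => (s.ι.app (finiteCyclic x)).toFun ⟨x, mem_cyclic x⟩
      equivariant := fun m (x : X.carrier) => by
        have h : finiteCyclic (m • x) ≤ finiteCyclic x :=
          cyclic_le ((cyclic x).smul_mem m (mem_cyclic x))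
        exact (congr_toFun (s.w (homOfLE h)) ⟨m • x, mem_cyclic _⟩).symm.trans
          ((s.ι.app (finiteCyclic x)).equivariant m ⟨x, mem_cyclic x⟩) }
  fac s S := hom_ext fun x => by
    have h : finiteCyclic x.1 ≤ S := cyclic_le x.2
    exact (congr_toFun (s.w (homOfLE h)) ⟨x.1, mem_cyclic x.1⟩).symm
  uniq s f hf := hom_ext fun x =>
    congr_toFun (hf (finiteCyclic x)) ⟨x, mem_cyclic x⟩

end FiniteSubsets

/-- A finite `M`-set is isomorphic to one whose underlying set is `Fin n`. -/
lemma exists_iso_fin (Y : MSet M) [Finite Y.carrier] :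
    ∃ (n : ℕ) (a : MulAction M (ULift.{u} (Fin n))),
      Nonempty (Y ≅ (@MSet.mk M _ (ULift.{u} (Fin n)) a : MSet M)) := by
  obtain ⟨n, ⟨e⟩⟩ := Finite.exists_equiv_fin Y.carrier
  let e' : ULift.{u} (Fin n) ≃ Y.carrier := Equiv.ulift.trans e.symm
  let a : MulAction M (ULift.{u} (Fin n)) := e'.mulAction M
  let f : (⟨ULift.{u} (Fin n)⟩ : MSet M) ⟶ Y :=
    ⟨e', fun m x => e'.apply_symm_apply (m • e' x)⟩
  exact ⟨n, a, ⟨(isoOfBijective f e'.bijective).symm⟩⟩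

section Functor

variable {N : Type u} [Monoid N] [Finite M] (F : MSet M ⥤ MSet N)

/-- Every element of the value of a functor preserving filtered colimits comes from a finite
subset closed under the action. -/
lemma exists_finite_support
    (hcolim : ∀ (J : Type u) [SmallCategory J] [IsFiltered J],
      Limits.PreservesColimitsOfShape J F) (X : MSet M) (x : (F.obj X).carrier) :
    ∃ (S : FiniteSub X) (y : (F.obj (ofSub S.1)).carrier), (F.map (incl S.1)).toFun y = x := by
  have := hcolim (FiniteSub X)
  exact jointly_surjective
    (Limits.isColimitOfPreserves F (finiteSubCoconeIsColimit X)) x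

/-- A functor preserving limits and filtered colimits has a universal element. -/
lemma exists_universal_element (hlim : Limits.PreservesLimitsOfSize.{u, u} F)
    (hcolim : ∀ (J : Type u) [SmallCategory J] [IsFiltered J],
      Limits.PreservesColimitsOfShape J F) :
    ∃ (T : MSet M) (t : (F.obj T).carrier), ∀ (X : MSet M) (x : (F.obj X).carrier),
      ∃! f : T ⟶ X, (F.map f).toFun t = x := by
  let A := StructuredArrow (regular N) F
  let ι : Type u := Σ (n : ℕ) (a : MulAction M (ULift.{u} (Fin n))),
    (F.obj (@MSet.mk M _ (ULift.{u} (Fin n)) a : MSet M)).carrier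
  let B : ι → A := fun i => StructuredArrow.mk (Y := @MSet.mk M _ _ i.2.1) (pick i.2.2)
  have hB : ∀ Z : A, ∃ i, Nonempty (B i ⟶ Z) := by
    intro Z
    obtain ⟨S, y, hy⟩ := exists_finite_support F hcolim Z.right (Z.hom.toFun (1 : N))
    have : Finite (ofSub S.1).carrier := S.2
    obtain ⟨n, a, ⟨e⟩⟩ := exists_iso_fin (ofSub S.1)
    refine ⟨⟨n, a, (F.map e.hom).toFun y⟩,
      ⟨StructuredArrow.homMk (e.inv ≫ incl S.1) (regular_hom_ext ?_)⟩⟩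
    erw [comp_toFun, pick_one]
    rw [← comp_toFun, ← F.map_comp, e.hom_inv_id_assoc, hy]
  obtain ⟨W, hW⟩ := has_weakly_initial_of_weakly_initial_set_and_hasProducts hB
  have : Limits.HasInitial A := hasInitial_of_weakly_initial_and_hasWideEqualizers hW
  let I : A := Limits.initial A
  refine ⟨I.right, I.hom.toFun (1 : N), fun X x => ?_⟩
  let Z : A := StructuredArrow.mk (Y := X) (pick x)
  refine ⟨(Limits.initial.to Z).right, ?_, fun f hf => ?_⟩
  · exact (congr_toFun (StructuredArrow.w (Limits.initial.to Z)) (1 : N)).trans (pick_one x)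
  · let f' : I ⟶ Z := StructuredArrow.homMk f (regular_hom_ext (hf.trans (pick_one x).symm))
    exact congrArg CommaMorphism.right (Limits.initialIsInitial.hom_ext f' (Limits.initial.to Z))

/-- The object carrying a universal element of a functor preserving filtered colimits is
finite. -/
lemma finite_of_universal_element
    (hcolim : ∀ (J : Type u) [SmallCategory J] [IsFiltered J],
      Limits.PreservesColimitsOfShape J F) {T : MSet M} {t : (F.obj T).carrier}
    (ht : ∀ (X : MSet M) (x : (F.obj X).carrier), ∃! f : T ⟶ X, (F.map f).toFun t = x) :
    Finite T.carrier := by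
  obtain ⟨S, y, hy⟩ := exists_finite_support F hcolim T t
  obtain ⟨f, hf, -⟩ := ht _ y
  have h : f ≫ incl S.1 = 𝟙 T := (ht T t).unique
    (by rw [F.map_comp, comp_toFun, hf, hy]) (by rw [F.map_id, id_toFun])
  have := S.2
  refine Finite.of_injective (β := S.1) f.toFun fun a b hab => ?_
  have hab' := congrArg (MSetHom.toFun (incl S.1)) hab
  rwa [← comp_toFun, ← comp_toFun, h] at hab'

end Functor

end MSet

/-- A functor to `G`-sets with a universal element is represented by a biset: the right action
of `g` is the endomorphism classified by the `g`-translate of the universal element. -/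
lemma exists_biset_of_universal_element {H G : Type u} [Group H] [Group G]
    (F : MSet H ⥤ MSet G) {T : MSet H} {t : (F.obj T).carrier}
    (ht : ∀ (X : MSet H) (x : (F.obj X).carrier), ∃! f : T ⟶ X, (F.map f).toFun t = x) :
    ∃ B : Biset H G, B.carrier = T.carrier ∧ Nonempty (F ≅ bisetHomFunctor H G B) := by
  choose ρ hρ _ using fun g : G => ht T (g • t)
  have hρ_one : ρ 1 = 𝟙 T := (ht T t).unique (by rw [hρ, one_smul]) (by
    rw [F.map_id, MSet.id_toFun])
  have hρ_mul (g g' : G) : ρ (g * g') = ρ g ≫ ρ g' := (ht T ((g * g') • t)).unique (hρ _) (by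
    rw [F.map_comp, MSet.comp_toFun, hρ, (F.map _).equivariant, hρ, mul_smul])
  let B : Biset H G :=
    { carrier := T.carrier
      mulAction :=
        { smul := fun p x => (ρ p.2.unop).toFun (p.1 • x)
          one_smul := fun x => by
            change (ρ 1).toFun ((1 : H) • x) = x
            rw [hρ_one, one_smul, MSet.id_toFun]
          mul_smul := fun p q x => by
            change (ρ (q.2.unop * p.2.unop)).toFun ((p.1 * q.1) • x) =
              (ρ p.2.unop).toFun (p.1 • (ρ q.2.unop).toFun (q.1 • x))
            rw [hρ_mul, MSet.comp_toFun, mul_smul, (ρ q.2.unop).equivariant] } }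
  have left_smul (h : H) (x : T.carrier) :
      ((h, (1 : Gᵐᵒᵖ)) • (show B.carrier from x) : B.carrier) = (h • x : T.carrier) := by
    change (ρ 1).toFun (h • x) = h • x
    rw [hρ_one, MSet.id_toFun]
  have right_smul (g : G) (x : T.carrier) :
      (((1 : H), op g) • (show B.carrier from x) : B.carrier) = (ρ g).toFun x := by
    change (ρ g).toFun ((1 : H) • x) = _
    rw [one_smul]
  let hom (X : MSet H) (f : BisetHom B X) : T ⟶ X :=
    ⟨f.1, fun h x => (congrArg f.1 (left_smul h x)).symm.trans (f.2 h x)⟩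
  have hom_smul (X : MSet H) (g : G) (f : BisetHom B X) : hom X (g • f) = ρ g ≫ hom X f :=
    MSet.hom_ext fun x => congrArg f.1 (right_smul g x)
  let ev (X : MSet H) : (bisetHomFunctor H G B).obj X ⟶ F.obj X :=
    { toFun := fun f => (F.map (hom X f)).toFun t
      equivariant := fun g (f : BisetHom B X) => by
        change (F.map (hom X (g • f))).toFun t = _
        rw [hom_smul, F.map_comp, MSet.comp_toFun, hρ, (F.map _).equivariant] }
  have ev_bijective (X : MSet H) : Function.Bijective (ev X).toFun := by
    refine ⟨fun f f' hff' => ?_, fun x => ?_⟩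
    · exact Subtype.ext (congrArg MSetHom.toFun ((ht X _).unique hff' rfl))
    · obtain ⟨f, hf, -⟩ := ht X x
      exact ⟨⟨f.toFun, fun h y => (congrArg f.toFun (left_smul h y)).trans (f.equivariant h y)⟩,
        hf⟩
  refine ⟨B, rfl, ⟨(NatIso.ofComponents (fun X => MSet.isoOfBijective (ev X) (ev_bijective X))
    fun {X Y} φ => MSet.hom_ext fun f => ?_).symm⟩⟩
  change (F.map (hom X f ≫ φ)).toFun t = (F.map φ).toFun ((F.map (hom X f)).toFun t)
  rw [F.map_comp, MSet.comp_toFun]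

/-!
STATEMENT 2: Let `H` and `G` be finite groups and let `F : Set_H ⥤ Set_G` be a functor which
preserves all small limits and all filtered colimits.  Then `F` is naturally isomorphic to the
functor `Hom_H(T, −)` for some finite `(H,G)`-biset `T`.
-/

theorem representable_of_preserves_limits_and_filtered_colimits
    [Finite H] [Finite G] (F : MSet H ⥤ MSet G)
    (hlim : Limits.PreservesLimitsOfSize.{u, u} F)
    (hcolim : ∀ (J : Type u) [SmallCategory J] [IsFiltered J],
      Limits.PreservesColimitsOfShape J F) :
    ∃ T : Biset H G, Finite T.carrier ∧ Nonempty (F ≅ bisetHomFunctor H G T) := by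
  obtain ⟨T, t, ht⟩ := MSet.exists_universal_element F hlim hcolim
  obtain ⟨B, hB, e⟩ := exists_biset_of_universal_element F ht
  exact ⟨B, hB ▸ MSet.finite_of_universal_element F hcolim ht, e⟩
end

section
/- The relation ≤ on reduced filtered dimension sequences, defined as the reflexive–transitive closure of the collapse and splitting moves, is a partial order: if D ≤ D' and D' ≤ D, then D = D'. -/
/-- A (reduced) filtered dimension sequence is modelled as a list of blocks, each block being a
list of positive integers.  (A block should be nonempty; this is expressed by `Reduced`.) -/
abbrev FSeq : Type := List (List ℕ+)

/-- Every block of the sequence is nonempty. -/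
def FSeq.Reduced (D : FSeq) : Prop := ∀ b ∈ D, b ≠ []

/-- The dimension of a single block: the sum of its entries. -/
def blockDim (b : List ℕ+) : ℕ := (b.map (fun d => (d : ℕ))).sum

/-- The total dimension `|D|` of a filtered dimension sequence. -/
def FSeq.totalDim (D : FSeq) : ℕ := (D.map blockDim).sum

/-- The length `l(D)` of a filtered dimension sequence: the sum of the lengths of its blocks. -/
def FSeq.len (D : FSeq) : ℕ := (D.map List.length).sum

/-- The two elementary moves on filtered dimension sequences:
* `collapse` replaces one block `x ++ [d, e] ++ y` by `x ++ [d + e] ++ y` (merging two adjacent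
  entries of a block of length `≥ 2`);
* `split` replaces one block `x ++ y` (with `x`, `y` nonempty) by the two adjacent blocks
  `x`, `y`.
All other blocks are unchanged. -/
inductive FSeq.Move : FSeq → FSeq → Prop
  | collapse (A C : FSeq) (x y : List ℕ+) (d e : ℕ+) :
      FSeq.Move (A ++ [x ++ d :: e :: y] ++ C) (A ++ [x ++ (d + e) :: y] ++ C)
  | split (A C : FSeq) (x y : List ℕ+) (hx : x ≠ []) (hy : y ≠ []) :
      FSeq.Move (A ++ [x ++ y] ++ C) (A ++ [x, y] ++ C)

/-- `D ≤ D'`: `D'` is obtained from `D` by a finite sequence of collapses and splittings. -/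
def FSeq.Le : FSeq → FSeq → Prop := Relation.ReflTransGen FSeq.Move

/-- Each elementary move lowers the difference between the length of a sequence and its number of
blocks by exactly one. -/
theorem FSeq.Move.len_sub_length {D D' : FSeq} (h : FSeq.Move D D') :
    (FSeq.len D' : ℤ) - D'.length + 1 = FSeq.len D - D.length := by
  cases h <;> simp [FSeq.len] <;> ring

theorem FSeq.Le.len_sub_length_le {D D' : FSeq} (h : FSeq.Le D D') :
    (FSeq.len D' : ℤ) - D'.length ≤ FSeq.len D - D.length := by
  induction h with
  | refl => exact le_rfl
  | tail _ hm ih =>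
    have := hm.len_sub_length
    linarith

theorem fseq_le_antisymm (D D' : FSeq) (hD : D.Reduced) (hD' : D'.Reduced)
    (h : FSeq.Le D D') (h' : FSeq.Le D' D) : D = D' := by
  obtain rfl | ⟨E, hm, hE⟩ := Relation.ReflTransGen.cases_head h
  · rfl
  · have h₁ := hm.len_sub_length
    have h₂ := FSeq.Le.len_sub_length_le hE
    have h₃ := h'.len_sub_length_le
    linarith
end

section
/- Let m ≥ 1 and let D be a reduced filtered dimension sequence with |D| = m. Then D ≤ (⟨m⟩), where (⟨m⟩) denotes the sequence consisting of the single one-entry block ⟨m⟩, if and only if D consists of exactly one block. Moreover, (⟨m⟩) ≤ D holds only for D = (⟨m⟩). -/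
/-!
STATEMENT 9: Let `m ≥ 1` and let `D` be a reduced filtered dimension sequence with `|D| = m`.
Then `D ≤ (⟨m⟩)` (the sequence with the single one-entry block `⟨m⟩`) if and only if `D`
consists of exactly one block.  Moreover `(⟨m⟩) ≤ D` holds only for `D = (⟨m⟩)`.
-/

theorem FSeq.Move.length_le {D D' : FSeq} (h : FSeq.Move D D') : D.length ≤ D'.length := by
  cases h <;> simp

theorem FSeq.Le.length_le {D D' : FSeq} (h : FSeq.Le D D') : D.length ≤ D'.length := by
  induction h with
  | refl => exact le_rfl
  | tail _ hmove ih => exact ih.trans hmove.length_le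

theorem FSeq.not_move_singleton (a : ℕ+) (D : FSeq) : ¬ FSeq.Move [[a]] D := by
  intro h
  generalize hS : ([[a]] : FSeq) = S at h
  cases h with
  | collapse A C x y d e =>
    simp [List.singleton_eq_append_iff, List.append_eq_singleton_iff] at hS
  | split A C x y hx hy =>
    simp [List.singleton_eq_append_iff, List.append_eq_singleton_iff, hx, hy] at hS

theorem FSeq.exists_le_singleton (l : List ℕ+) :
    ∀ a : ℕ+, ∃ s : ℕ+, FSeq.Le [a :: l] [[s]] ∧ (s : ℕ) = blockDim (a :: l) := by
  induction l with
  | nil => exact fun a => ⟨a, .refl, by simp [blockDim]⟩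
  | cons b l ih =>
    intro a
    obtain ⟨s, hle, hs⟩ := ih (a + b)
    exact ⟨s, .head (FSeq.Move.collapse [] [] [] l a b) hle, by simp [hs, blockDim, add_assoc]⟩

theorem fseq_le_single_block (m : ℕ+) (D : FSeq) (hD : D.Reduced)
    (hdim : D.totalDim = m) :
    (FSeq.Le D [[m]] ↔ D.length = 1) ∧ (FSeq.Le [[m]] D → D = [[m]]) := by
  refine ⟨⟨fun h => ?_, fun h => ?_⟩, fun h => ?_⟩
  · refine le_antisymm h.length_le (List.length_pos_iff.2 ?_)
    rintro rfl
    exact m.ne_zero hdim.symm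
  · obtain ⟨b, rfl⟩ := List.length_eq_one_iff.1 h
    obtain ⟨a, l, rfl⟩ := List.exists_cons_of_ne_nil (hD b (by simp))
    obtain ⟨s, hle, hs⟩ := FSeq.exists_le_singleton l a
    have hsm : s = m := PNat.eq (by simpa [hs, FSeq.totalDim] using hdim)
    exact hsm ▸ hle
  · rcases Relation.ReflTransGen.cases_head h with h | ⟨E, hmove, -⟩
    · exact h.symm
    · exact (FSeq.not_move_singleton m E hmove).elim
end

section
/- Let i ≥ 1 and let D be a reduced filtered dimension sequence all of whose entries are at most i. Then there exists a reduced filtered dimension sequence D' with D ≤ D' such that every block of D' either is the one-entry block ⟨i⟩ or has all of its entries at most i − 1. -/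
/-- Splitting repeatedly takes a nonempty block to the sequence of its one-entry blocks. -/
theorem FSeq.le_singletons_block (A C : FSeq) (b : List ℕ+) (hb : b ≠ []) :
    FSeq.Le (A ++ [b] ++ C) (A ++ b.map (fun d => [d]) ++ C) := by
  induction b generalizing A with
  | nil => exact absurd rfl hb
  | cons d t ih =>
    rcases eq_or_ne t [] with rfl | ht
    · exact .refl
    · have hsplit : FSeq.Move (A ++ [d :: t] ++ C) (A ++ [[d], t] ++ C) :=
        .split A C [d] t (List.cons_ne_nil _ _) ht
      refine Relation.ReflTransGen.head hsplit ?_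
      simpa [FSeq.Le] using ih (A ++ [[d]]) ht

/-- Splitting repeatedly takes a reduced sequence to the sequence of one-entry blocks formed by
its entries. -/
theorem FSeq.le_singletons (A D : FSeq) (hD : D.Reduced) :
    FSeq.Le (A ++ D) (A ++ D.flatten.map (fun d => [d])) := by
  induction D generalizing A with
  | nil => exact .refl
  | cons b D ih =>
    have hblock := FSeq.le_singletons_block A D b (hD b List.mem_cons_self)
    have htail := ih (A ++ b.map (fun d => [d])) fun c hc => hD c (List.mem_cons_of_mem _ hc)
    simpa [FSeq.Le] using Relation.ReflTransGen.trans hblock htail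

/-!
STATEMENT 10: Let `i ≥ 1` and let `D` be a reduced filtered dimension sequence all of whose
entries are at most `i`.  Then there exists a reduced filtered dimension sequence `D'` with
`D ≤ D'` such that every block of `D'` either is the one-entry block `⟨i⟩` or has all of its
entries at most `i − 1`.
-/

theorem fseq_le_refine (i : ℕ+) (D : FSeq) (hD : D.Reduced)
    (hent : ∀ b ∈ D, ∀ d ∈ b, d ≤ i) :
    ∃ D' : FSeq, D'.Reduced ∧ FSeq.Le D D' ∧
      ∀ b ∈ D', b = [i] ∨ ∀ d ∈ b, (d : ℕ) ≤ (i : ℕ) - 1 := by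
  refine ⟨D.flatten.map (fun d => [d]), ?_, FSeq.le_singletons [] D hD, ?_⟩
  · intro b hb
    obtain ⟨d, -, rfl⟩ := List.mem_map.mp hb
    exact List.cons_ne_nil _ _
  · intro b hb
    obtain ⟨d, hd, rfl⟩ := List.mem_map.mp hb
    obtain ⟨c, hc, hdc⟩ := List.mem_flatten.mp hd
    rcases (hent c hc d hdc).eq_or_lt with rfl | hlt
    · exact .inl rfl
    · refine .inr fun e he => ?_
      rw [List.mem_singleton.mp he]
      exact Nat.le_sub_one_of_lt (PNat.coe_lt_coe _ _ |>.mpr hlt)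
end

section
/- Let i ≥ 1 and let D = (b_1,…,b_j) be a reduced filtered dimension sequence such that each block b_r either is the one-entry block ⟨i+1⟩ or has all of its entries at most i. Let D₀ be a reduced filtered dimension sequence with all entries at most i and with D₀ ≤ D. Then there exists a reduced filtered dimension sequence D₁ = (c_1,…,c_j) with exactly j blocks such that D₀ ≤ D₁, D₁ ≤ D, every entry of D₁ is at most i, the dimension of c_r equals the dimension of b_r for every r, and c_r = b_r whenever b_r has length greater than 1. -/
/-!
STATEMENT 11: Let `i ≥ 1` and let `D = (b_1,…,b_j)` be a reduced filtered dimension sequence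
such that each block `b_r` either is the one-entry block `⟨i+1⟩` or has all of its entries at
most `i`.  Let `D₀` be a reduced filtered dimension sequence with all entries at most `i` and
with `D₀ ≤ D`.  Then there exists a reduced filtered dimension sequence `D₁ = (c_1,…,c_j)` with
exactly `j` blocks such that `D₀ ≤ D₁`, `D₁ ≤ D`, every entry of `D₁` is at most `i`, the
dimension of `c_r` equals the dimension of `b_r` for every `r`, and `c_r = b_r` whenever `b_r`
has length greater than `1`.
-/

/-- A single collapse inside one block. -/
def BlockMove (s t : List ℕ+) : Prop :=
  ∃ (x y : List ℕ+) (d e : ℕ+), s = x ++ d :: e :: y ∧ t = x ++ (d + e) :: y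

/-- `BlockLe s t`: the block `t` is obtained from `s` by finitely many collapses. -/
def BlockLe : List ℕ+ → List ℕ+ → Prop := Relation.ReflTransGen BlockMove

theorem BlockMove.exists_append {s x y : List ℕ+} (h : BlockMove s (x ++ y)) :
    ∃ s₁ s₂, s = s₁ ++ s₂ ∧ BlockLe s₁ x ∧ BlockLe s₂ y := by
  obtain ⟨u, v, d, e, rfl, h⟩ := h
  rcases List.append_eq_append_iff.1 h with ⟨a, rfl, rfl⟩ | ⟨c, rfl, hc⟩
  · exact ⟨x, a ++ d :: e :: v, by simp, .refl, .single ⟨a, v, d, e, rfl, rfl⟩⟩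
  · cases c with
    | nil =>
      obtain rfl : (d + e) :: v = y := by simpa using hc
      exact ⟨u, d :: e :: v, rfl, by simpa using .refl, .single ⟨[], v, d, e, rfl, rfl⟩⟩
    | cons f c =>
      obtain ⟨rfl, rfl⟩ : d + e = f ∧ v = c ++ y := by simpa using hc
      exact ⟨u ++ d :: e :: c, y, by simp, .single ⟨u, c, d, e, rfl, rfl⟩, .refl⟩

theorem BlockLe.exists_append {s t : List ℕ+} (h : BlockLe s t) :
    ∀ x y, t = x ++ y → ∃ s₁ s₂, s = s₁ ++ s₂ ∧ BlockLe s₁ x ∧ BlockLe s₂ y := by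
  induction h with
  | refl => exact fun x y hxy => ⟨x, y, hxy, .refl, .refl⟩
  | tail _ hm ih =>
    rintro x y rfl
    obtain ⟨t₁, t₂, rfl, h₁, h₂⟩ := hm.exists_append
    obtain ⟨s₁, s₂, rfl, h₁', h₂'⟩ := ih t₁ t₂ rfl
    exact ⟨s₁, s₂, rfl, h₁'.trans h₁, h₂'.trans h₂⟩

theorem BlockLe.ne_nil {s t : List ℕ+} (h : BlockLe s t) (ht : t ≠ []) : s ≠ [] := by
  induction h with
  | refl => exact ht
  | tail _ hm ih =>
    obtain ⟨x, y, d, e, rfl, rfl⟩ := hm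
    exact ih (by simp)

theorem BlockLe.blockDim_eq {s t : List ℕ+} (h : BlockLe s t) : blockDim s = blockDim t := by
  induction h with
  | refl => rfl
  | tail _ hm ih =>
    obtain ⟨x, y, d, e, rfl, rfl⟩ := hm
    rw [ih]
    simp [blockDim, add_assoc]

theorem List.Forall₂.exists_of_append_cons {α β : Type*} {R : α → β → Prop} {b : β} {C : List β} :
    ∀ {A : List β} {S : List α}, List.Forall₂ R S (A ++ b :: C) →
      ∃ A' b' C', S = A' ++ b' :: C' ∧ List.Forall₂ R A' A ∧ R b' b ∧ List.Forall₂ R C' C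
  | [], _, .cons hb hC => ⟨[], _, _, rfl, .nil, hb, hC⟩
  | _ :: _, _, .cons ha h => by
    obtain ⟨A', b', C', rfl, hA, hb, hC⟩ := exists_of_append_cons h
    exact ⟨_ :: A', b', C', rfl, .cons ha hA, hb, hC⟩

theorem FSeq.Le.cons {D E : FSeq} (h : FSeq.Le D E) (b : List ℕ+) :
    FSeq.Le (b :: D) (b :: E) := by
  refine Relation.ReflTransGen.lift (List.cons b) (fun _ _ hm => ?_) _ _ h
  cases hm with
  | collapse A C x y d e => exact .collapse (b :: A) C x y d e
  | split A C x y hx hy => exact .split (b :: A) C x y hx hy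

theorem BlockLe.fseqLe_cons {s t : List ℕ+} (h : BlockLe s t) (C : FSeq) :
    FSeq.Le (s :: C) (t :: C) := by
  refine Relation.ReflTransGen.lift (fun b => (b :: C : FSeq)) (fun _ _ hm => ?_) _ _ h
  obtain ⟨x, y, d, e, rfl, rfl⟩ := hm
  exact .collapse [] C x y d e

theorem FSeq.Le.of_forall₂ {S D : FSeq} (h : List.Forall₂ BlockLe S D) : FSeq.Le S D := by
  induction h with
  | nil => exact .refl
  | cons hb _ ih => exact (hb.fseqLe_cons _).trans (ih.cons _)

/-- Splittings can be performed before collapses. -/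
theorem FSeq.Le.exists_forall₂ {D₀ D : FSeq} (h : FSeq.Le D₀ D) :
    ∃ S : FSeq, FSeq.Le D₀ S ∧ S.flatten = D₀.flatten ∧ List.Forall₂ BlockLe S D := by
  induction h with
  | refl => exact ⟨D₀, .refl, rfl, List.forall₂_same.2 fun _ _ => .refl⟩
  | tail _ hm ih =>
    obtain ⟨S, hS, hflat, hSE⟩ := ih
    cases hm with
    | collapse A C x y d e =>
      rw [List.append_assoc] at hSE
      obtain ⟨A', b, C', rfl, hA, hb, hC⟩ := hSE.exists_of_append_cons
      refine ⟨_, hS, hflat, ?_⟩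
      rw [List.append_assoc]
      exact List.rel_append hA (.cons (hb.tail ⟨x, y, d, e, rfl, rfl⟩) hC)
    | split A C x y hx hy =>
      rw [List.append_assoc] at hSE
      obtain ⟨A', b, C', rfl, hA, hb, hC⟩ := hSE.exists_of_append_cons
      obtain ⟨s, t, rfl, hs, ht⟩ := hb.exists_append x y rfl
      refine ⟨A' ++ [s, t] ++ C', hS.tail ?_, ?_, ?_⟩
      · simpa using FSeq.Move.split A' C' s t (hs.ne_nil hx) (ht.ne_nil hy)
      · simpa using hflat
      · exact List.rel_append (List.rel_append hA (.cons hs (.cons ht .nil))) hC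

/-- In a blockwise collapse, one may stop halfway by performing only the collapses
that create no entry larger than `i`. -/
theorem exists_forall₂_blockLe_of_entries_le {i : ℕ+} {S D : FSeq}
    (h : List.Forall₂ BlockLe S D) (hS : ∀ b ∈ S, ∀ d ∈ b, d ≤ i)
    (hD : ∀ b ∈ D, b = [i + 1] ∨ ∀ d ∈ b, d ≤ i) :
    ∃ D₁ : FSeq, List.Forall₂ BlockLe S D₁ ∧ (∀ b ∈ D₁, ∀ d ∈ b, d ≤ i) ∧
      List.Forall₂ (fun c b => BlockLe c b ∧ (1 < b.length → c = b)) D₁ D := by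
  induction h with
  | nil => exact ⟨[], .nil, by simp, .nil⟩
  | @cons s b S D hb _ ih =>
    rw [List.forall_mem_cons] at hS hD
    obtain ⟨D₁, h₁, h₂, h₃⟩ := ih hS.2 hD.2
    rcases hD.1 with rfl | hi
    · exact ⟨s :: D₁, .cons .refl h₁, List.forall_mem_cons.2 ⟨hS.1, h₂⟩,
        .cons ⟨hb, by simp⟩ h₃⟩
    · exact ⟨b :: D₁, .cons hb h₁, List.forall_mem_cons.2 ⟨hi, h₂⟩,
        .cons ⟨.refl, fun _ => rfl⟩ h₃⟩

theorem fseq_slice_cofinal (i : ℕ+) (D D₀ : FSeq) (hD : D.Reduced) (hD₀ : D₀.Reduced)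
    (hblocks : ∀ b ∈ D, b = [i + 1] ∨ ∀ d ∈ b, d ≤ i)
    (hent₀ : ∀ b ∈ D₀, ∀ d ∈ b, d ≤ i)
    (hle : FSeq.Le D₀ D) :
    ∃ D₁ : FSeq, D₁.Reduced ∧ D₁.length = D.length ∧
      FSeq.Le D₀ D₁ ∧ FSeq.Le D₁ D ∧
      (∀ b ∈ D₁, ∀ d ∈ b, d ≤ i) ∧
      ∀ (r : ℕ) (hr : r < D.length) (hr' : r < D₁.length),
        blockDim (D₁.get ⟨r, hr'⟩) = blockDim (D.get ⟨r, hr⟩) ∧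
          (1 < (D.get ⟨r, hr⟩).length → D₁.get ⟨r, hr'⟩ = D.get ⟨r, hr⟩) := by
  obtain ⟨S, hS, hflat, hSD⟩ := hle.exists_forall₂
  have hSi : ∀ b ∈ S, ∀ d ∈ b, d ≤ i := fun b hb d hd => by
    have hmem : d ∈ D₀.flatten := hflat ▸ List.mem_flatten.2 ⟨b, hb, hd⟩
    obtain ⟨c, hc, hdc⟩ := List.mem_flatten.1 hmem
    exact hent₀ c hc d hdc
  obtain ⟨D₁, hSD₁, hi, hD₁D⟩ := exists_forall₂_blockLe_of_entries_le hSD hSi hblocks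
  refine ⟨D₁, fun c hc => ?_, hD₁D.length_eq, hS.trans (FSeq.Le.of_forall₂ hSD₁),
    .of_forall₂ (hD₁D.imp fun _ _ h => h.1), hi, fun r hr hr' => ?_⟩
  · obtain ⟨r, hr, rfl⟩ := List.getElem_of_mem hc
    exact (hD₁D.get hr (hD₁D.length_eq ▸ hr)).1.ne_nil (hD _ (List.get_mem _ _))
  · have h := hD₁D.get hr' hr
    exact ⟨h.1.blockDim_eq, h.2⟩
end

section
/- Let p be a prime and let k be an algebraically closed field of characteristic p. Let F: W(k) → W(k) denote the Frobenius endomorphism of the ring of p-typical Witt vectors of k (the ring map induced by x ↦ x^p, well defined since k is perfect). Then the additive endomorphism id − F of W(k) is surjective, and its kernel equals the image of the natural ring homomorphism W(F_p) → W(k) induced by the inclusion of the prime field F_p into k; in particular there is a short exact sequence of abelian groups 0 → W(F_p) → W(k) → W(k) → 0, where the second map is id − F and W(F_p) ≅ ℤ_p. -/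
/-!
STATEMENT 15: Let `p` be a prime and `k` an algebraically closed field of characteristic `p`.
Let `F : W(k) → W(k)` be the Frobenius endomorphism of the ring of `p`-typical Witt vectors of
`k` (the ring map induced by `x ↦ x^p`, well defined since `k` is perfect).  Then `id − F` is a
surjective additive endomorphism of `W(k)`, and its kernel is exactly the image of the natural
ring homomorphism `W(𝔽_p) → W(k)` induced by the inclusion of the prime field `𝔽_p = ZMod p`
into `k`; in particular there is a short exact sequence of abelian groups
`0 → W(𝔽_p) → W(k) → W(k) → 0` (the second map being `id − F`), with `W(𝔽_p) ≅ ℤ_p`.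
-/

open WittVector

theorem surjective_sub_map_of_isAdicComplete {R : Type*} [CommRing R] (π : R)
    [IsAdicComplete (Ideal.span {π}) R] (φ : R →+* R) (hπ : φ π = π)
    (h : ∀ x, ∃ b y, x = b - φ b + π * y) : Function.Surjective fun x => x - φ x := by
  choose b y hby using h
  intro x
  let r : ℕ → R := fun n => y^[n] x
  let s : ℕ → R := fun n => ∑ i ∈ Finset.range n, π ^ i * b (r i)
  have hs (n : ℕ) : x - (s n - φ (s n)) = π ^ n * r n := by
    induction n with
    | zero => simp [s, r]
    | succ n ih =>
      have hr : r (n + 1) = y (r n) := Function.iterate_succ_apply' ..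
      have hsn : s (n + 1) = s n + π ^ n * b (r n) := Finset.sum_range_succ ..
      rw [hsn, hr, map_add, map_mul, map_pow, hπ]
      linear_combination ih + π ^ n * hby (r n)
  obtain ⟨l, hl⟩ := IsPrecomplete.prec (I := Ideal.span {π}) (M := R) inferInstance (f := s) (by
    intro m n hmn
    rw [SModEq.sub_mem, smul_eq_mul, Ideal.mul_top, Ideal.span_singleton_pow,
      Ideal.mem_span_singleton, dvd_sub_comm]
    simp only [s]
    rw [← Finset.sum_range_add_sum_Ico _ hmn, add_sub_cancel_left]
    exact Finset.dvd_sum fun i hi =>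
      Dvd.dvd.mul_right (pow_dvd_pow π (Finset.mem_Ico.mp hi).1) _)
  refine ⟨l, (sub_eq_zero.mp <| IsHausdorff.haus (I := Ideal.span {π}) inferInstance _ ?_).symm⟩
  intro n
  have hn := hl n
  rw [SModEq.sub_mem, smul_eq_mul, Ideal.mul_top, Ideal.span_singleton_pow,
    Ideal.mem_span_singleton] at hn ⊢
  obtain ⟨c, hc⟩ := hn
  have hφ : φ (s n) - φ l = π ^ n * φ c := by rw [← map_sub, hc, map_mul, map_pow, hπ]
  exact ⟨r n + c - φ c, by linear_combination hs n + hc - hφ⟩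

open Polynomial in
theorem IsAlgClosed.exists_sub_pow_eq {k : Type*} [Field k] [IsAlgClosed k] {n : ℕ} (hn : 1 < n)
    (c : k) : ∃ a : k, a - a ^ n = c := by
  have hlt : (-X + C c : k[X]).degree < n :=
    (by compute_degree : (-X + C c : k[X]).degree ≤ 1).trans_lt (mod_cast hn)
  have hd : (X ^ n + (-X + C c) : k[X]).degree ≠ 0 := by
    rw [degree_add_eq_left_of_degree_lt (by rwa [degree_X_pow]), degree_X_pow]
    exact_mod_cast (by omega : n ≠ 0)
  obtain ⟨a, ha⟩ := IsAlgClosed.exists_root _ hd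
  refine ⟨a, ?_⟩
  simp only [IsRoot.def, eval_add, eval_pow, eval_X, eval_neg, eval_C] at ha
  linear_combination -ha

theorem mem_range_zmod_castHom_iff (p : ℕ) [Fact p.Prime] {k : Type*} [Field k] [CharP k p]
    {a : k} : (∃ b, ZMod.castHom (dvd_refl p) k b = a) ↔ a ^ p = a := by
  rw [← Subfield.mem_bot_iff_pow_eq_self, ← ZMod.fieldRange_castHom_eq_bot p,
    RingHom.mem_fieldRange]

theorem WittVector.mem_range_map_iff {p : ℕ} [Fact p.Prime] {R S : Type*} [CommRing R]
    [CommRing S] (f : R →+* S) (x : WittVector p S) :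
    x ∈ Set.range (WittVector.map f) ↔ ∀ n, ∃ a, f a = x.coeff n := by
  constructor
  · rintro ⟨y, rfl⟩ n
    exact ⟨y.coeff n, (map_coeff f y n).symm⟩
  · intro h
    choose a ha using h
    exact ⟨.mk p a, WittVector.ext fun n => by rw [map_coeff, coeff_mk, ha]⟩

theorem artin_schreier_witt
    (p : ℕ) [hp : Fact p.Prime] (k : Type*) [Field k] [IsAlgClosed k] [CharP k p] :
    -- the Frobenius `F = W(x ↦ x^p)` on `W(k)`
    (Function.Surjective
      (fun x : WittVector p k => x - WittVector.map (frobenius k p) x)) ∧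
    (∀ x : WittVector p k,
        x - WittVector.map (frobenius k p) x = 0 ↔
          x ∈ Set.range (WittVector.map (ZMod.castHom (dvd_refl p) k))) ∧
    Function.Injective (WittVector.map (ZMod.castHom (dvd_refl p) k) :
      WittVector p (ZMod p) → WittVector p k) ∧
    Nonempty (WittVector p (ZMod p) ≃+* ℤ_[p]) := by
  refine ⟨surjective_sub_map_of_isAdicComplete (p : WittVector p k) _ (map_natCast _ p) ?_,
    fun x => ?_, WittVector.map_injective _ (ZMod.castHom (dvd_refl p) k).injective,
    ⟨WittVector.equiv p⟩⟩
  · intro x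
    obtain ⟨a, ha⟩ := IsAlgClosed.exists_sub_pow_eq hp.out.one_lt (x.coeff 0)
    have hx : x - (teichmuller p a - WittVector.map (frobenius k p) (teichmuller p a)) ∈
        Ideal.span {(p : WittVector p k)} := by
      rw [← ker_constantCoeff, RingHom.mem_ker]
      simp only [map_sub, constantCoeff_apply, map_coeff, teichmuller_coeff_zero, frobenius_def]
      rw [ha, sub_self]
    obtain ⟨y, hy⟩ := Ideal.mem_span_singleton.mp hx
    exact ⟨teichmuller p a, y, by linear_combination hy⟩
  · rw [WittVector.mem_range_map_iff, sub_eq_zero, eq_comm, WittVector.ext_iff]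
    simp only [mem_range_zmod_castHom_iff, map_coeff, frobenius_def]
end
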